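/- An algebra (S,⊔,∩) is an ado-semilattice if and only if there exist sets X and Y and an injective map φ : S → Par(X,Y) such that φ(a⊔b) = φ(a)⊔φ(b) and φ(a∩b) = φ(a)∩φ(b) for all a, b ∈ S, where on Par(X,Y) the operation ⊔ is override and ∩ is intersection. Hence the class of functional algebras of signature (⊔,∩) is finitely axiomatised as the variety of ado-semilattices. -/

import Mathlib

universe u

/- Partial functions from `X` to `Y` are modelled as maps `X → Option Y`
(equivalently, single-valued subsets of `X × Y`). -/

/-- Override: `f ⊔ g` agrees with `f` on `dom f` and with `g` on
`dom g \ dom f`. -/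
def pOv {X Y : Type*} (f g : X → Option Y) : X → Option Y :=
  fun x => (f x).or (g x)

open Classical in
/-- Intersection of graphs. -/
noncomputable def pInt {X Y : Type*} (f g : X → Option Y) : X → Option Y :=
  fun x => if f x = g x then f x else none

open Classical in
/-- Restricted union: the restriction of the relation `f ∪ g` to the points
where it is single-valued. -/
noncomputable def pRU {X Y : Type*} (f g : X → Option Y) : X → Option Y :=
  fun x =>
    if f x = none then g x
    else if g x = none then f x
    else if f x = g x then f x else none

/-- An ado-semilattice: `(S,∩)` is a meet-semilattice; with `x ≤ y` meaning
`x∩y = x`, the four o-semilattice laws hold; `⊔` is associative; and the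
distributivity law holds. -/
structure IsAdo {S : Type*} (inter ov : S → S → S) : Prop where
  inter_comm : ∀ a b, inter a b = inter b a
  inter_assoc : ∀ a b c, inter (inter a b) c = inter a (inter b c)
  inter_idem : ∀ a, inter a a = a
  le1 : ∀ x y, inter x (ov x y) = x
  le2 : ∀ x y z, inter (ov (inter x y) (inter y z)) y = ov (inter x y) (inter y z)
  le3 : ∀ x y, inter (ov x y) (ov x (inter y (ov x y))) = ov x y
  le4 : ∀ x y z, inter (inter x z) (ov (inter x y) z) = inter x z
  ov_assoc : ∀ x y z, ov (ov x y) z = ov x (ov y z)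
  distrib : ∀ a b c d,
    ov (inter a d) (inter (inter b d) (inter c d)) =
      inter (ov (inter a d) (inter b d)) (ov (inter a d) (inter c d))

namespace IsAdo

section Order

variable {S : Type*} [SemilatticeInf S] {ov : S → S → S} {a b c d e x y z : S}

theorem le_ov_left (h : IsAdo (· ⊓ ·) ov) : x ≤ ov x y :=
  inf_eq_left.mp (h.le1 x y)

theorem ov_le (h : IsAdo (· ⊓ ·) ov) (hx : x ≤ d) (hy : y ≤ d) : ov x y ≤ d := by
  have := h.le2 x d y
  simp only [inf_eq_left.mpr hx, inf_eq_right.mpr hy] at this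
  exact inf_eq_left.mp this

theorem inf_le_ov (h : IsAdo (· ⊓ ·) ov) (hy : y ≤ x) : x ⊓ z ≤ ov y z := by
  have := h.le4 x y z
  simp only [inf_eq_right.mpr hy] at this
  exact inf_eq_left.mp this

theorem le_ov_right (h : IsAdo (· ⊓ ·) ov) (hx : x ≤ d) (hy : y ≤ d) : y ≤ ov x y :=
  (le_inf hy le_rfl).trans (h.inf_le_ov hx)

theorem ov_comm_of_le (h : IsAdo (· ⊓ ·) ov) (hx : x ≤ d) (hy : y ≤ d) : ov x y = ov y x :=
  le_antisymm (h.ov_le (h.le_ov_right hy hx) h.le_ov_left)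
    (h.ov_le (h.le_ov_right hx hy) h.le_ov_left)

theorem ov_eq_right (h : IsAdo (· ⊓ ·) ov) (hx : x ≤ d) : ov x d = d :=
  le_antisymm (h.ov_le hx le_rfl) (h.le_ov_right hx le_rfl)

theorem ov_inf_ov (h : IsAdo (· ⊓ ·) ov) : ov x (y ⊓ ov x y) = ov x y :=
  le_antisymm (h.ov_le h.le_ov_left inf_le_right) (inf_eq_left.mp (h.le3 x y))

theorem ov_inf_of_le (h : IsAdo (· ⊓ ·) ov) (ha : a ≤ d) (hb : b ≤ d) (hc : c ≤ d) :
    ov a (b ⊓ c) = ov a b ⊓ ov a c := by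
  have := h.distrib a b c d
  simpa only [inf_eq_left.mpr ha, inf_eq_left.mpr hb, inf_eq_left.mpr hc] using this

theorem inf_ov_of_le (h : IsAdo (· ⊓ ·) ov) (hx : x ≤ d) (hy : y ≤ d) (hz : z ≤ d) :
    z ⊓ ov x y ≤ ov (z ⊓ x) (z ⊓ y) := by
  have hzx : z ⊓ x ≤ d := inf_le_left.trans hz
  rw [h.ov_inf_of_le hzx hz hy, h.ov_eq_right inf_le_left, h.ov_comm_of_le hzx hy,
    h.ov_inf_of_le hy hz hx, h.ov_comm_of_le hy hx]
  exact le_inf inf_le_left (le_inf (inf_le_left.trans (h.le_ov_right hy hz)) inf_le_right)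

/-- Meets distribute over an arbitrary override, after trimming its second argument. -/
theorem inf_ov_le (h : IsAdo (· ⊓ ·) ov) (hz : z ≤ ov x y) (hx : z ⊓ x ≤ e) (hy : z ⊓ y ≤ e) :
    z ≤ e := by
  have hz' : z ≤ ov x (y ⊓ ov x y) := by rwa [h.ov_inf_ov]
  calc z ≤ z ⊓ ov x (y ⊓ ov x y) := le_inf le_rfl hz'
    _ ≤ ov (z ⊓ x) (z ⊓ (y ⊓ ov x y)) := h.inf_ov_of_le h.le_ov_left inf_le_right hz
    _ ≤ e := h.ov_le hx ((inf_le_inf_left z inf_le_left).trans hy)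

end Order

end IsAdo

/-- A nonempty filter of a meet-semilattice that is prime with respect to `ov`. -/
structure IsOvPrime {S : Type*} [SemilatticeInf S] (ov : S → S → S) (F : Set S) : Prop where
  nonempty : F.Nonempty
  mem_of_le : ∀ {x y}, x ≤ y → x ∈ F → y ∈ F
  inf_mem : ∀ {x y}, x ∈ F → y ∈ F → x ⊓ y ∈ F
  mem_or_mem : ∀ {x y}, ov x y ∈ F → x ∈ F ∨ y ∈ F

/-- The elements of `S` that are defined at the point given by a prime filter `F`. -/
def ovDom {S : Type*} (ov : S → S → S) (F : Set S) : Set S :=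
  {x | ∀ f ∈ F, ov x f ∈ F → x ∈ F}

theorem subset_ovDom {S : Type*} {ov : S → S → S} {F : Set S} : F ⊆ ovDom ov F :=
  fun _ hx _ _ _ => hx

section Separation

variable {S : Type*} [SemilatticeInf S] {ov : S → S → S} {a b : S}

theorem IsAdo.exists_isOvPrime (h : IsAdo (· ⊓ ·) ov) (hab : ¬ a ≤ b) :
    ∃ F, IsOvPrime ov F ∧ a ∈ F ∧ b ∉ F := by
  let P : Set (Set S) := {F | a ∈ F ∧ b ∉ F ∧ (∀ x y, x ≤ y → x ∈ F → y ∈ F) ∧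
    ∀ x y, x ∈ F → y ∈ F → x ⊓ y ∈ F}
  obtain ⟨F, -, hF⟩ := zorn_subset_nonempty P (by
    intro C hC hchain ⟨G, hG⟩
    refine ⟨⋃₀ C, ⟨⟨G, hG, (hC hG).1⟩, ?_, ?_, ?_⟩, fun s hs => Set.subset_sUnion_of_mem hs⟩
    · rintro ⟨H, hH, hb⟩
      exact (hC hH).2.1 hb
    · rintro x y hxy ⟨H, hH, hx⟩
      exact ⟨H, hH, (hC hH).2.2.1 x y hxy hx⟩
    · rintro x y ⟨H, hH, hx⟩ ⟨K, hK, hy⟩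
      rcases hchain.total hH hK with hHK | hKH
      · exact ⟨K, hK, (hC hK).2.2.2 x y (hHK hx) hy⟩
      · exact ⟨H, hH, (hC hH).2.2.2 x y hx (hKH hy)⟩)
    (Set.Ici a) ⟨le_rfl, hab, fun _ _ hxy hx => le_trans hx hxy, fun _ _ => le_inf⟩
  obtain ⟨ha, hb, hup, hinf⟩ := hF.prop
  have hext : ∀ x, x ∉ F → ∃ f ∈ F, f ⊓ x ≤ b := by
    intro x hx
    by_contra! hcon
    have hG : {y | ∃ f ∈ F, f ⊓ x ≤ y} ∈ P := by
      refine ⟨⟨a, ha, inf_le_left⟩, fun ⟨f, hf, hfb⟩ => hcon f hf hfb,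
        fun y z hyz ⟨f, hf, hfy⟩ => ⟨f, hf, hfy.trans hyz⟩, ?_⟩
      rintro y z ⟨f, hf, hfy⟩ ⟨g, hg, hgz⟩
      exact ⟨f ⊓ g, hinf f g hf hg, le_inf ((inf_le_inf_right x inf_le_left).trans hfy)
        ((inf_le_inf_right x inf_le_right).trans hgz)⟩
    exact hx (hF.le_of_ge hG (fun y hy => ⟨y, hy, inf_le_left⟩) ⟨a, ha, inf_le_right⟩)
  refine ⟨F, ⟨⟨a, ha⟩, fun {x y} => hup x y, fun {x y} => hinf x y, fun {x y} hxy => ?_⟩, ha, hb⟩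
  by_contra! hcon
  obtain ⟨f, hf, hfx⟩ := hext x hcon.1
  obtain ⟨g, hg, hgy⟩ := hext y hcon.2
  refine hb (hup (f ⊓ g ⊓ ov x y) b (h.inf_ov_le inf_le_right ?_ ?_)
    (hinf _ _ (hinf f g hf hg) hxy))
  · exact (inf_le_inf_right x (inf_le_left.trans inf_le_left)).trans hfx
  · exact (inf_le_inf_right y (inf_le_left.trans inf_le_right)).trans hgy

end Separation

namespace IsOvPrime

variable {S : Type*} [SemilatticeInf S] {ov : S → S → S} {F : Set S} {a b c d e f g p q x y : S}

theorem ov_mem_of_ov_mem (h : IsAdo (· ⊓ ·) ov) (hF : IsOvPrime ov F) (hg : g ∈ F)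
    (hx : ov x f ∈ F) : ov x g ∈ F :=
  hF.mem_of_le (h.inf_le_ov h.le_ov_left) (hF.inf_mem hx hg)

theorem not_mem_ovDom_iff (h : IsAdo (· ⊓ ·) ov) (hF : IsOvPrime ov F) (hf : f ∈ F) :
    x ∉ ovDom ov F ↔ x ∉ F ∧ ov x f ∈ F := by
  constructor
  · intro hx
    simp only [ovDom, Set.mem_ofPred_eq, not_forall] at hx
    obtain ⟨g, hg, hxg, hxF⟩ := hx
    exact ⟨hxF, hF.ov_mem_of_ov_mem h hf hxg⟩
  · exact fun hx hD => hx.1 (hD f hf hx.2)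

theorem ovDom_mem_of_le (h : IsAdo (· ⊓ ·) ov) (hF : IsOvPrime ov F) (hxy : x ≤ y)
    (hx : x ∈ ovDom ov F) : y ∈ ovDom ov F := fun _ hf hy =>
  hF.mem_of_le hxy (hx _ hf (hF.mem_of_le (h.inf_le_ov (hxy.trans h.le_ov_left))
    (hF.inf_mem hy hf)))

theorem mem_of_mem_ovDom_of_le (h : IsAdo (· ⊓ ·) ov) (hx : x ∈ ovDom ov F) (hy : y ∈ F)
    (hxy : x ≤ y) : x ∈ F :=
  hx y hy (by rwa [h.ov_eq_right hxy])

theorem ov_mem_ovDom_iff (h : IsAdo (· ⊓ ·) ov) (hF : IsOvPrime ov F) (he : e ∉ ovDom ov F) :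
    ov e x ∈ ovDom ov F ↔ x ∈ ovDom ov F := by
  obtain ⟨f, hf⟩ := hF.nonempty
  have heF := ((hF.not_mem_ovDom_iff h hf).mp he).1
  have key : ∀ y, ov e y ∈ F ↔ y ∈ F := fun y =>
    ⟨fun hy => (hF.mem_or_mem hy).resolve_left heF,
      fun hy => ((hF.not_mem_ovDom_iff h hy).mp he).2⟩
  rw [← not_iff_not, hF.not_mem_ovDom_iff h hf, hF.not_mem_ovDom_iff h hf, h.ov_assoc, key, key]

theorem inf_ov_mem_ovDom (h : IsAdo (· ⊓ ·) ov) (hF : IsOvPrime ov F) (he : e ∉ ovDom ov F)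
    (hx : x ∈ ovDom ov F) : x ⊓ ov e x ∈ ovDom ov F := by
  rwa [← hF.ov_mem_ovDom_iff h he, h.ov_inf_ov, hF.ov_mem_ovDom_iff h he]

theorem inf_mem_ovDom (h : IsAdo (· ⊓ ·) ov) (hF : IsOvPrime ov F) (hpd : p ≤ d) (hqd : q ≤ d)
    (hp : p ∈ ovDom ov F) (hq : q ∈ ovDom ov F) : p ⊓ q ∈ ovDom ov F := by
  by_contra hpq
  obtain ⟨f, hf⟩ := hF.nonempty
  obtain ⟨hpqF, hr⟩ := (hF.not_mem_ovDom_iff h hf).mp hpq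
  set r := ov (p ⊓ q) f
  have hdF : d ∉ F := fun hd => hpqF (hF.inf_mem (mem_of_mem_ovDom_of_le h hp hd hpd)
    (mem_of_mem_ovDom_of_le h hq hd hqd))
  have hpr : ov p r ∉ F := fun hc => hdF (hF.mem_of_le hpd (hp r hr hc))
  set r' := r ⊓ ov p r
  have hr' : r' ∉ ovDom ov F := fun hc =>
    hpr (hF.mem_of_le inf_le_right (mem_of_mem_ovDom_of_le h hc hr inf_le_left))
  set q' := q ⊓ ov r' q
  have hq' : q' ∈ ovDom ov F := hF.inf_ov_mem_ovDom h hr' hq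
  have hq'd : q' ≤ d := inf_le_left.trans hqd
  have hm : ov p (ov r q) = ov (ov p q') r' := by
    rw [← h.ov_assoc, ← h.ov_inf_ov (x := p) (y := r), h.ov_assoc,
      ← h.ov_inf_ov (x := r') (y := q), h.ov_assoc,
      h.ov_comm_of_le (x := r') (d := ov r' q) h.le_ov_left inf_le_right]
  have hq'm : q' ≤ ov p (ov r q) := by
    rw [hm]
    exact (h.le_ov_right hpd hq'd).trans h.le_ov_left
  have hq's : q' ≤ ov r q := by
    refine h.inf_ov_le hq'm ?_ inf_le_right
    exact (le_inf inf_le_right (inf_le_left.trans inf_le_left)).trans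
      (h.le_ov_left.trans h.le_ov_left)
  have : ov q' r ∈ F := hF.mem_of_le (h.le_ov_right hq's h.le_ov_left) hr
  exact hdF (hF.mem_of_le hq'd (hq' r hr this))

theorem inf_mem_ovDom_trans (h : IsAdo (· ⊓ ·) ov) (hF : IsOvPrime ov F)
    (hab : a ⊓ b ∈ ovDom ov F) (hbc : b ⊓ c ∈ ovDom ov F) : a ⊓ c ∈ ovDom ov F :=
  hF.ovDom_mem_of_le h (inf_le_inf inf_le_left inf_le_right)
    (hF.inf_mem_ovDom h (d := b) inf_le_right inf_le_left hab hbc)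

open Classical in
/-- The value of `x` at the point given by a prime filter `F`, as a class of elements
of `S` agreeing there. -/
noncomputable def value (ov : S → S → S) (F : Set S) (x : S) : Option (Set S) :=
  if x ∈ ovDom ov F then some {y | x ⊓ y ∈ ovDom ov F} else none

theorem value_eq_of_inf_mem (h : IsAdo (· ⊓ ·) ov) (hF : IsOvPrime ov F)
    (hab : a ⊓ b ∈ ovDom ov F) : value ov F a = value ov F b := by
  have ha := hF.ovDom_mem_of_le h inf_le_left hab
  have hb := hF.ovDom_mem_of_le h inf_le_right hab
  simp only [value, ha, hb, if_true, Option.some.injEq]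
  ext y
  exact ⟨hF.inf_mem_ovDom_trans h (inf_comm a b ▸ hab), hF.inf_mem_ovDom_trans h hab⟩

theorem inf_mem_of_value_eq (ha : a ∈ ovDom ov F) (hab : value ov F a = value ov F b) :
    a ⊓ b ∈ ovDom ov F := by
  by_cases hb : b ∈ ovDom ov F
  · simp only [value, ha, hb, if_true, Option.some.injEq] at hab
    have : b ∈ {y | b ⊓ y ∈ ovDom ov F} := by simpa using hb
    rwa [← hab] at this
  · simp [value, ha, hb] at hab

theorem value_ov (h : IsAdo (· ⊓ ·) ov) (hF : IsOvPrime ov F) :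
    value ov F (ov a b) = (value ov F a).or (value ov F b) := by
  by_cases ha : a ∈ ovDom ov F
  · have : a ⊓ ov a b ∈ ovDom ov F := by rwa [inf_eq_left.mpr h.le_ov_left]
    rw [← hF.value_eq_of_inf_mem h this]
    simp [value, ha]
  · have hiff := hF.ov_mem_ovDom_iff h (x := b) ha
    have hna : value ov F a = none := by simp [value, ha]
    rw [hna, Option.none_or]
    by_cases hb : b ∈ ovDom ov F
    · exact (hF.value_eq_of_inf_mem h (hF.inf_ov_mem_ovDom h ha hb)).symm
    · simp [value, hiff, hb]

open Classical in
theorem value_inf (h : IsAdo (· ⊓ ·) ov) (hF : IsOvPrime ov F) :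
    value ov F (a ⊓ b) = if value ov F a = value ov F b then value ov F a else none := by
  by_cases hab : a ⊓ b ∈ ovDom ov F
  · rw [if_pos (hF.value_eq_of_inf_mem h hab)]
    exact hF.value_eq_of_inf_mem h (by rwa [inf_eq_left.mpr inf_le_left])
  · have hn : value ov F (a ⊓ b) = none := by simp [value, hab]
    rw [hn]
    split_ifs with heq
    · by_cases ha : a ∈ ovDom ov F
      · exact absurd (inf_mem_of_value_eq ha heq) hab
      · simp [value, ha]
    · rfl

end IsOvPrime

theorem IsAdo.exists_representation_of_semilatticeInf {S : Type u} [SemilatticeInf S]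
    {ov : S → S → S} (h : IsAdo (· ⊓ ·) ov) :
    ∃ (X Y : Type u) (φ : S → X → Option Y),
      Function.Injective φ ∧
      (∀ a b, φ (ov a b) = pOv (φ a) (φ b)) ∧
      (∀ a b, φ (a ⊓ b) = pInt (φ a) (φ b)) := by
  refine ⟨{F : Set S // IsOvPrime ov F}, Set S, fun x F => IsOvPrime.value ov F.1 x, ?_,
    fun a b => funext fun F => F.2.value_ov h, fun a b => funext fun F => F.2.value_inf h⟩
  have key : ∀ a b : S, (∀ F : {F : Set S // IsOvPrime ov F},
      IsOvPrime.value ov F.1 a = IsOvPrime.value ov F.1 b) → a ≤ b := by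
    intro a b hab
    by_contra hle
    obtain ⟨F, hF, ha, hb⟩ := h.exists_isOvPrime hle
    have := IsOvPrime.inf_mem_of_value_eq (subset_ovDom ha) (hab ⟨F, hF⟩)
    exact hb (hF.mem_of_le inf_le_right
      (IsOvPrime.mem_of_mem_ovDom_of_le h this ha inf_le_left))
  intro a b hab
  exact le_antisymm (key a b (congrFun hab)) (key b a fun F => (congrFun hab F).symm)

theorem IsAdo.exists_representation {S : Type u} {inter ov : S → S → S} (h : IsAdo inter ov) :
    ∃ (X Y : Type u) (φ : S → X → Option Y),
      Function.Injective φ ∧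
      (∀ a b, φ (ov a b) = pOv (φ a) (φ b)) ∧
      (∀ a b, φ (inter a b) = pInt (φ a) (φ b)) := by
  let _ : SemilatticeInf S :=
    { le := fun a b => inter a b = a
      le_refl := h.inter_idem
      le_trans := fun a b c hab hbc => by
        rw [← hab, h.inter_assoc, hbc]
      le_antisymm := fun a b hab hba => by rw [← hab, h.inter_comm, hba]
      inf := inter
      inf_le_left := fun a b => by
        rw [h.inter_comm, ← h.inter_assoc, h.inter_idem]
      inf_le_right := fun a b => by
        rw [h.inter_assoc, h.inter_idem]
      le_inf := fun a b c hab hac => by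
        rw [← h.inter_assoc, hab, hac] }
  exact IsAdo.exists_representation_of_semilatticeInf (ov := ov) h

theorem isAdo_partialFunctions (X Y : Type*) :
    IsAdo (pInt : (X → Option Y) → (X → Option Y) → X → Option Y) pOv where
  inter_comm a b := by funext t; simp only [pInt]; grind
  inter_assoc a b c := by funext t; simp only [pInt]; grind
  inter_idem a := by funext t; simp only [pInt]; grind
  le1 x y := by
    funext t
    obtain hx | ⟨v, hx⟩ := Option.eq_none_or_eq_some (x t) <;> simp [pInt, pOv, hx]
  le2 x y z := by funext t; simp only [pInt, pOv]; grind
  le3 x y := by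
    funext t
    obtain hx | ⟨v, hx⟩ := Option.eq_none_or_eq_some (x t) <;> simp [pInt, pOv, hx]
  le4 x y z := by funext t; simp only [pInt, pOv]; grind
  ov_assoc x y z := by funext t; simp only [pOv]; grind
  distrib a b c d := by funext t; simp only [pInt, pOv]; grind

theorem IsAdo.of_injective {S T : Type*} {inter ov : S → S → S} {inter' ov' : T → T → T}
    (h : IsAdo inter' ov') {φ : S → T} (hφ : Function.Injective φ)
    (hov : ∀ a b, φ (ov a b) = ov' (φ a) (φ b))
    (hinter : ∀ a b, φ (inter a b) = inter' (φ a) (φ b)) : IsAdo inter ov where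
  inter_comm a b := hφ (by simp only [hinter, h.inter_comm (φ a)])
  inter_assoc a b c := hφ (by simp only [hinter, h.inter_assoc])
  inter_idem a := hφ (by simp only [hinter, h.inter_idem])
  le1 x y := hφ (by simp only [hinter, hov, h.le1])
  le2 x y z := hφ (by simp only [hinter, hov, h.le2])
  le3 x y := hφ (by simp only [hinter, hov, h.le3])
  le4 x y z := hφ (by simp only [hinter, hov, h.le4])
  ov_assoc x y z := hφ (by simp only [hov, h.ov_assoc])
  distrib a b c d := hφ (by simp only [hinter, hov, h.distrib])

/-- An algebra `(S,⊔,∩)` is an ado-semilattice iff there exist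
sets `X, Y` and an injective map `φ : S → Par(X,Y)` with `φ(a⊔b) = φ(a)⊔φ(b)`
and `φ(a∩b) = φ(a)∩φ(b)`, where on `Par(X,Y)` the operation `⊔` is override
and `∩` is intersection of graphs.  Hence the class of functional algebras of
signature `(⊔,∩)` is finitely axiomatised as the variety of ado-semilattices. -/
theorem stmt_18 {S : Type u} (inter ov : S → S → S) :
    IsAdo inter ov ↔
      ∃ (X Y : Type u) (φ : S → X → Option Y),
        Function.Injective φ ∧
        (∀ a b, φ (ov a b) = pOv (φ a) (φ b)) ∧
        (∀ a b, φ (inter a b) = pInt (φ a) (φ b)) :=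
  ⟨IsAdo.exists_representation, fun ⟨X, Y, _, hφ, hov, hinter⟩ =>
    (isAdo_partialFunctions X Y).of_injective hφ hov hinter⟩
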